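/- Let E be a real inner product space, let θ ∈ E, let L₂ : E → ℝ be differentiable at θ with gradient ∇L₂(θ), let Ω be a finite nonempty set (hyper-network parameters), let Λ be a set (soft-label assignments), let G : Ω → Λ and Γ : Λ → E, and set g(ω) = Γ(G(ω)). Suppose ω* ∈ Ω strictly maximizes ⟨g(ω), ∇L₂(θ)⟩ over Ω, i.e. ⟨g(ω*), ∇L₂(θ)⟩ > ⟨g(ω), ∇L₂(θ)⟩ for every ω ≠ ω*. Then there exists η₀ > 0 such that for every learning rate η with 0 < η < η₀ and every ω ≠ ω*, one has L₂(θ − η·g(ω*)) < L₂(θ − η·g(ω)); that is, ω* is the unique minimizer of ω ↦ L₂(θ − η·g(ω)). -/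

import Mathlib

open scoped RealInnerProductSpace

open Filter Topology

/-- Derivative at zero step size of a function along a descent step with direction `v`. -/
lemma HasGradientAt.hasDerivAt_sub_smul
    {E : Type*} [NormedAddCommGroup E] [InnerProductSpace ℝ E] [CompleteSpace E]
    {θ gradL : E} {L : E → ℝ} (hL : HasGradientAt L gradL θ) (v : E) :
    HasDerivAt (fun η : ℝ => L (θ - η • v)) (-⟪v, gradL⟫) 0 := by
  have hline : HasDerivAt (fun η : ℝ => θ - η • v) (-v) 0 := by
    simpa using ((hasDerivAt_id (0 : ℝ)).smul_const v).const_sub θ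
  have hL' : HasFDerivAt L (InnerProductSpace.toDual ℝ E gradL) (θ - (0 : ℝ) • v) := by
    simpa using hL.hasFDerivAt
  simpa [Function.comp_def, real_inner_comm] using hL'.comp_hasDerivAt 0 hline

/-- Of two functions that agree at a point, the one with the smaller derivative there is
strictly smaller immediately to the right. -/
lemma HasDerivAt.eventually_lt_nhdsGT {f g : ℝ → ℝ} {f' g' x : ℝ}
    (hf : HasDerivAt f f' x) (hg : HasDerivAt g g' x) (hx : f x = g x) (h : f' < g') :
    ∀ᶠ y in 𝓝[>] x, f y < g y := by
  have hslope := (hg.sub hf).hasDerivWithinAt (s := Set.Ioi x)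
  rw [hasDerivWithinAt_iff_tendsto_slope' (by simp)] at hslope
  filter_upwards [hslope.eventually (lt_mem_nhds (sub_pos.mpr h)), self_mem_nhdsWithin]
    with y hy hxy
  rw [slope_def_field, div_pos_iff_of_pos_right (sub_pos.mpr hxy)] at hy
  simp only [Pi.sub_apply] at hy
  linarith

/-- Hyper-network version: with `g ω = Γ (G ω)` the inner-loop gradient induced by the soft
labels `G ω`, if `ω*` strictly maximizes `⟪g ω, ∇L₂(θ)⟫` over the finite nonempty parameter
set `Ω`, then for all sufficiently small learning rates `η > 0`, `ω*` is the unique minimizer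
of the outer loss after the one-step update `θ - η • g ω`. -/
theorem hypernetwork_strict_inner_maximizer_is_unique_one_step_minimizer
    {E : Type*} [NormedAddCommGroup E] [InnerProductSpace ℝ E] [CompleteSpace E]
    (θ : E) (L₂ : E → ℝ) (gradL : E) (hL : HasGradientAt L₂ gradL θ)
    {Ω : Type*} [Fintype Ω] [Nonempty Ω] {Λ : Type*}
    (G : Ω → Λ) (Γ : Λ → E) (ωstar : Ω)
    (hmax : ∀ ω : Ω, ω ≠ ωstar → ⟪Γ (G ω), gradL⟫ < ⟪Γ (G ωstar), gradL⟫) :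
    ∃ η₀ > (0 : ℝ), ∀ η : ℝ, 0 < η → η < η₀ → ∀ ω : Ω, ω ≠ ωstar →
      L₂ (θ - η • Γ (G ωstar)) < L₂ (θ - η • Γ (G ω)) := by
  have hev : ∀ᶠ η in 𝓝[>] (0 : ℝ), ∀ ω : Ω, ω ≠ ωstar →
      L₂ (θ - η • Γ (G ωstar)) < L₂ (θ - η • Γ (G ω)) := by
    refine eventually_all.mpr fun ω => eventually_imp_distrib_left.mpr fun hω => ?_
    exact (hL.hasDerivAt_sub_smul _).eventually_lt_nhdsGT (hL.hasDerivAt_sub_smul _)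
      (by simp) (neg_lt_neg (hmax ω hω))
  obtain ⟨η₀, hη₀, hsub⟩ := mem_nhdsGT_iff_exists_Ioo_subset.mp hev
  exact ⟨η₀, hη₀, fun η hpos hlt => hsub ⟨hpos, hlt⟩⟩
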